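/- arXiv:math/0512626 — 3 statements merged into one kernel-verified Lean document; each statement's English description precedes it below -/
import Mathlib

section
/- Let f : (X,E) → (Y,F) be a countable-to-one Borel function between quotient Borel spaces. Then the image f[A] of every Borel subset A ⊆ (X,E) is a Borel subset of (Y,F). -/
open MeasureTheory Set

/-- A subset of the quotient is Borel iff its preimage under the projection is Borel. -/
def QBorelSet {X : Type} [MeasurableSpace X] (E : Setoid X) (A : Set (Quotient E)) : Prop :=
  MeasurableSet (Quotient.mk E ⁻¹' A)

/-- A relation between quotient Borel spaces is Borel iff its pullback to the
product of the standard Borel spaces is Borel. -/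
def QBorelRel {X Y : Type} [MeasurableSpace X] [MeasurableSpace Y]
    (E : Setoid X) (F : Setoid Y) (R : Set (Quotient E × Quotient F)) : Prop :=
  MeasurableSet {p : X × Y | (Quotient.mk E p.1, Quotient.mk F p.2) ∈ R}

/-- A function between quotient Borel spaces is Borel iff its graph is a Borel relation. -/
def QBorelFun {X Y : Type} [MeasurableSpace X] [MeasurableSpace Y]
    (E : Setoid X) (F : Setoid Y) (f : Quotient E → Quotient F) : Prop :=
  MeasurableSet {p : X × Y | f (Quotient.mk E p.1) = Quotient.mk F p.2}

/-- `E` is a countable Borel equivalence relation. -/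
def CBER {X : Type} [MeasurableSpace X] (E : Setoid X) : Prop :=
  MeasurableSet {p : X × X | E.r p.1 p.2} ∧ ∀ x : X, {y | E.r x y}.Countable

/-- `E` is smooth: Borel reducible to equality on some standard Borel space. -/
def SmoothRel {X : Type} [MeasurableSpace X] (E : Setoid X) : Prop :=
  ∃ (Y : Type) (_ : MeasurableSpace Y) (_ : StandardBorelSpace Y) (f : X → Y),
    Measurable f ∧ ∀ x y : X, E.r x y ↔ f x = f y

section CountableToOne

open TopologicalSpace Filter Topology

/-- The set of points sharing their `g`-fiber with another point of `k '' t` is analytic. -/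
theorem analyticSet_setOf_exists_ne_mem_image {S Z Y : Type*}
    [MeasurableSpace S] [StandardBorelSpace S]
    [TopologicalSpace Z] [PolishSpace Z] [MeasurableSpace Z] [BorelSpace Z]
    [MeasurableSpace Y] [StandardBorelSpace Y] {g : Z → Y} (hg : Measurable g)
    {k : S → Z} (hk : Measurable k) {t : Set S} (ht : MeasurableSet t) :
    AnalyticSet {z | ∃ w ∈ k '' t, w ≠ z ∧ g w = g z} := by
  have hm : MeasurableSet {p : S × Z | p.1 ∈ t ∧ k p.1 ≠ p.2 ∧ g (k p.1) = g p.2} :=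
    (measurable_fst ht).inter
      ((measurableSet_eq_fun (hk.comp measurable_fst) measurable_snd).compl.inter
        (measurableSet_eq_fun (hg.comp (hk.comp measurable_fst)) (hg.comp measurable_snd)))
  convert hm.analyticSet_image measurable_snd using 1
  ext z
  constructor
  · rintro ⟨_, ⟨u, hu, rfl⟩, h1, h2⟩
    exact ⟨(u, z), ⟨hu, h1, h2⟩, rfl⟩
  · rintro ⟨⟨u, z⟩, ⟨hu, h1, h2⟩, rfl⟩
    exact ⟨_, ⟨u, hu, rfl⟩, h1, h2⟩

/-- If a Borel map `g` is injective on an analytic set, presented as the measurable image `h '' S`,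
then it is injective on a Borel set containing it. -/
theorem exists_measurableSet_injOn_of_injOn_image {S Z Y : Type*}
    [MeasurableSpace S] [StandardBorelSpace S]
    [TopologicalSpace Z] [PolishSpace Z] [MeasurableSpace Z] [BorelSpace Z]
    [MeasurableSpace Y] [StandardBorelSpace Y] {g : Z → Y} (hg : Measurable g)
    {h : S → Z} (hh : Measurable h) {s : Set S} (hs : MeasurableSet s)
    (hinj : InjOn g (h '' s)) :
    ∃ B, MeasurableSet B ∧ InjOn g B ∧ h '' s ⊆ B := by
  have hA : AnalyticSet (h '' s) := hs.analyticSet_image hh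
  obtain ⟨B₁, hAB₁, hdisj₁, hB₁⟩ := hA.measurablySeparable (analyticSet_setOf_exists_ne_mem_image hg hh hs) <|
    disjoint_left.2 fun z hz ⟨w, hw, hne, he⟩ => hne (hinj hw hz he)
  obtain ⟨B₂, hAB₂, hdisj₂, hB₂⟩ := hA.measurablySeparable
    (analyticSet_setOf_exists_ne_mem_image hg measurable_id hB₁) <| disjoint_left.2 fun z hz ⟨w, hw, hne, he⟩ =>
      disjoint_left.1 hdisj₁ ⟨z, hz, hne.symm, he.symm⟩ (by simpa using hw)
  refine ⟨B₁ ∩ B₂, hB₁.inter hB₂, ?_, subset_inter hAB₁ hAB₂⟩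
  intro x hx y hy hxy
  by_contra hne
  exact disjoint_left.1 hdisj₂ ⟨x, by simpa using hx.1, hne, hxy⟩ hy.2

/-- A sequence `W` of sets is *fiber-large* for `g` if, after removing any countable family of
measurable sets on which `g` is injective, some fiber of `g` still meets all the `W i`. -/
def FiberLarge {Z Y : Type*} [MeasurableSpace Z] (g : Z → Y) (W : ℕ → Set Z) : Prop :=
  ∀ 𝓑 : Set (Set Z), 𝓑.Countable → (∀ B ∈ 𝓑, MeasurableSet B ∧ InjOn g B) →
    ∃ γ : ℕ → Z, ∀ i, γ i ∈ W i ∧ γ i ∉ ⋃₀ 𝓑 ∧ g (γ i) = g (γ 0)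

theorem FiberLarge.exists_split {Z Y : Type*} [MetricSpace Z] [PolishSpace Z]
    [MeasurableSpace Z] [BorelSpace Z] [MeasurableSpace Y] [StandardBorelSpace Y]
    {g : Z → Y} (hg : Measurable g) {W : ℕ → Set Z} (hW : FiberLarge g W)
    (hWm : ∀ i, MeasurableSet (W i)) {a b : ℕ} (hab : a ≠ b) {ε : ℝ} (hε : 0 < ε) :
    ∃ V₀ V₁ : Set Z, MeasurableSet V₀ ∧ MeasurableSet V₁ ∧ V₀ ⊆ W a ∧ V₁ ⊆ W a ∧
      (∀ x ∈ V₀, ∀ y ∈ V₀, dist x y ≤ ε) ∧ Disjoint (closure V₀) (closure V₁) ∧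
      FiberLarge g (Function.update (Function.update W a V₀) b V₁) := by
  by_contra! hcon
  let J : Set (Set Z × Set Z) := {p | p.1 ∈ countableBasis Z ∧ p.2 ∈ countableBasis Z ∧
    (∀ x ∈ p.1, ∀ y ∈ p.1, dist x y ≤ ε) ∧ Disjoint (closure p.1) (closure p.2)}
  have hJ : J.Countable :=
    Countable.mono (fun p (hp : p ∈ J) => mk_mem_prod hp.1 hp.2.1)
      ((countable_countableBasis Z).prod (countable_countableBasis Z))
  have hex : ∀ p : J, ∃ 𝓑 : Set (Set Z), 𝓑.Countable ∧
      (∀ B ∈ 𝓑, MeasurableSet B ∧ InjOn g B) ∧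
      ¬ ∃ γ : ℕ → Z, ∀ i, γ i ∈ Function.update (Function.update W a (W a ∩ p.1.1)) b
        (W a ∩ p.1.2) i ∧ γ i ∉ ⋃₀ 𝓑 ∧ g (γ i) = g (γ 0) := by
    rintro ⟨⟨U₀, U₁⟩, h₀, h₁, hd, hc⟩
    have := hcon (W a ∩ U₀) (W a ∩ U₁)
      ((hWm a).inter (isOpen_of_mem_countableBasis h₀).measurableSet)
      ((hWm a).inter (isOpen_of_mem_countableBasis h₁).measurableSet)
      inter_subset_left inter_subset_left (fun x hx y hy => hd x hx.2 y hy.2)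
      (hc.mono (closure_mono inter_subset_right) (closure_mono inter_subset_right))
    unfold FiberLarge at this
    push Not at this
    obtain ⟨𝓑, h1, h2, h3⟩ := this
    exact ⟨𝓑, h1, h2, by push Not; exact h3⟩
  choose 𝓑 h𝓑c h𝓑m h𝓑 using hex
  have : Countable J := hJ.to_subtype
  let 𝓒 : Set (Set Z) := ⋃ p, 𝓑 p
  have h𝓒c : 𝓒.Countable := countable_iUnion h𝓑c
  have h𝓒m : ∀ B ∈ 𝓒, MeasurableSet B ∧ InjOn g B := by
    intro B hB
    obtain ⟨p, hp⟩ := mem_iUnion.1 hB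
    exact h𝓑m p B hp
  have h𝓑𝓒 : ∀ p, ⋃₀ 𝓑 p ⊆ ⋃₀ 𝓒 := fun p => sUnion_subset_sUnion (subset_iUnion 𝓑 p)
  let s : Set (ℕ → Z) := {γ | ∀ i, γ i ∈ W i ∧ γ i ∉ ⋃₀ 𝓒 ∧ g (γ i) = g (γ 0)}
  have hs : MeasurableSet s := by
    have h𝓒 : MeasurableSet (⋃₀ 𝓒) := MeasurableSet.sUnion h𝓒c fun B hB => (h𝓒m B hB).1
    have heq : s = ⋂ i, (fun γ : ℕ → Z => γ i) ⁻¹' W i ∩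
        ((fun γ : ℕ → Z => γ i) ⁻¹' (⋃₀ 𝓒)ᶜ ∩ {γ | g (γ i) = g (γ 0)}) := by
      ext γ
      simp [s]
    rw [heq]
    exact MeasurableSet.iInter fun i => (measurable_pi_apply i (hWm i)).inter
      ((measurable_pi_apply i h𝓒.compl).inter
        (measurableSet_eq_fun (hg.comp (measurable_pi_apply i))
          (hg.comp (measurable_pi_apply 0))))
  have hinj : InjOn g ((fun γ : ℕ → Z => γ a) '' s) := by
    rintro _ ⟨γ, hγ, rfl⟩ _ ⟨δ, hδ, rfl⟩ hgd
    by_contra hne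
    have hne : γ a ≠ δ a := hne
    have hgd : g (γ a) = g (δ a) := hgd
    have hr : 0 < min (ε / 2) (dist (γ a) (δ a) / 3) :=
      lt_min (half_pos hε) (div_pos (dist_pos.2 hne) (by norm_num))
    set r := min (ε / 2) (dist (γ a) (δ a) / 3) with hrdef
    have hr1 : r ≤ ε / 2 := min_le_left _ _
    have hr2 : r ≤ dist (γ a) (δ a) / 3 := min_le_right _ _
    obtain ⟨U₀, hU₀, hγU, hU₀r⟩ := (isBasis_countableBasis Z).exists_subset_of_mem_open
      (Metric.mem_ball_self hr) (Metric.isOpen_ball (x := γ a) (ε := r))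
    obtain ⟨U₁, hU₁, hδU, hU₁r⟩ := (isBasis_countableBasis Z).exists_subset_of_mem_open
      (Metric.mem_ball_self hr) (Metric.isOpen_ball (x := δ a) (ε := r))
    have hcl : ∀ {U : Set Z} {c : Z}, U ⊆ Metric.ball c r → closure U ⊆ Metric.closedBall c r :=
      fun hU => closure_minimal (hU.trans Metric.ball_subset_closedBall) Metric.isClosed_closedBall
    have hp : (U₀, U₁) ∈ J := by
      refine ⟨hU₀, hU₁, fun x hx y hy => ?_, ?_⟩
      · have h1 := Metric.mem_ball.1 (hU₀r hx)
        have h2 := Metric.mem_ball.1 (hU₀r hy)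
        have := dist_triangle_right x y (γ a)
        linarith
      · refine (Metric.closedBall_disjoint_closedBall ?_).mono (hcl hU₀r) (hcl hU₁r)
        have := dist_pos.2 hne
        linarith
    have hγ0 : ∀ i, g (γ i) = g (γ a) := fun i => (hγ i).2.2.trans (hγ a).2.2.symm
    have hg' : ∀ i, g (Function.update γ b (δ a) i) = g (γ a) := by
      intro i
      by_cases hi : i = b
      · subst hi; simp [hgd]
      · simp [hi, hγ0]
    refine h𝓑 ⟨_, hp⟩ ⟨Function.update γ b (δ a), fun i => ⟨?_, fun hi => ?_, ?_⟩⟩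
    · by_cases hi : i = b
      · subst hi; simpa using ⟨(hδ a).1, hδU⟩
      · by_cases hia : i = a
        · subst hia; simpa [hi] using ⟨(hγ i).1, hγU⟩
        · simpa [hi, hia] using (hγ i).1
    · have hi := h𝓑𝓒 _ hi
      by_cases hib : i = b
      · subst hib; exact (hδ a).2.1 (by simpa using hi)
      · exact (hγ i).2.1 (by simpa [hib] using hi)
    · rw [hg', hg']
  obtain ⟨B, hBm, hBi, hB⟩ :=
    exists_measurableSet_injOn_of_injOn_image hg (measurable_pi_apply a) hs hinj
  obtain ⟨γ, hγ⟩ := hW (insert B 𝓒) (h𝓒c.insert B) (by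
    rintro B' (rfl | h)
    · exact ⟨hBm, hBi⟩
    · exact h𝓒m B' h)
  refine (hγ a).2.1 ⟨B, mem_insert _ _, hB ⟨γ, fun i => ⟨(hγ i).1, fun hi => ?_, (hγ i).2.2⟩, rfl⟩⟩
  exact (hγ i).2.1 (sUnion_subset_sUnion (subset_insert _ _) hi)

/-- A continuous map from a Polish space with a fiber-large sequence has an uncountable fiber. -/
theorem FiberLarge.exists_not_countable_fiber {Z Y : Type*} [MetricSpace Z] [CompleteSpace Z]
    [PolishSpace Z] [MeasurableSpace Z] [BorelSpace Z] [TopologicalSpace Y] [PolishSpace Y]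
    [MeasurableSpace Y] [BorelSpace Y] {g : Z → Y} (hg : Continuous g)
    (h : FiberLarge g fun _ => univ) : ∃ y, ¬ (g ⁻¹' {y}).Countable := by
  let L := {W : ℕ → Set Z // FiberLarge g W ∧ ∀ i, MeasurableSet (W i)}
  let k : ℕ → ℕ := fun n => n.unpair.1
  have hkn : ∀ n, k n ≤ n := Nat.unpair_left_le
  have step : ∀ (n : ℕ) (W : L), ∃ W' : L,
      (∀ i, i ≠ n + 1 → W'.1 i ⊆ W.1 i) ∧ W'.1 (n + 1) ⊆ W.1 (k n) ∧
      (∀ x ∈ W'.1 (k n), ∀ y ∈ W'.1 (k n), dist x y ≤ 1 / (n + 1 : ℝ)) ∧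
      Disjoint (closure (W'.1 (k n))) (closure (W'.1 (n + 1))) := by
    rintro n ⟨W, hW, hWm⟩
    have hne : k n ≠ n + 1 := by have := hkn n; omega
    obtain ⟨V₀, V₁, hm₀, hm₁, hs₀, hs₁, hd, hc, hl⟩ :=
      hW.exists_split hg.measurable hWm hne (ε := 1 / (n + 1 : ℝ)) (by positivity)
    refine ⟨⟨_, hl, fun i => ?_⟩, fun i hi => ?_, ?_, ?_, ?_⟩
    · by_cases hi : i = n + 1
      · subst hi; simpa using hm₁
      · by_cases hik : i = k n
        · subst hik; simpa [hi] using hm₀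
        · simpa [hi, hik] using hWm i
    · by_cases hik : i = k n
      · subst hik; simpa [hi] using hs₀
      · simp [hi, hik]
    · simpa using hs₁
    · simpa [hne] using hd
    · simpa [hne] using hc
  choose next hnext using step
  let U : ℕ → L := fun n => Nat.rec ⟨fun _ => univ, h, fun _ => MeasurableSet.univ⟩ next n
  have hU : ∀ n, U (n + 1) = next n (U n) := fun n => rfl
  have hmono : ∀ {i n m}, i ≤ n → n ≤ m → (U m).1 i ⊆ (U n).1 i := by
    intro i n m hin hnm
    induction m, hnm using Nat.le_induction with
    | base => exact Subset.rfl
    | succ m hnm ih =>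
      rw [hU]
      exact ((hnext m (U m)).1 i (by omega)).trans ih
  have hγ : ∀ n, ∃ γ : ℕ → Z, (∀ i, γ i ∈ (U n).1 i) ∧ ∀ i, g (γ i) = g (γ 0) := by
    intro n
    obtain ⟨γ, hγ⟩ := (U n).2.1 ∅ countable_empty (by simp)
    exact ⟨γ, fun i => (hγ i).1, fun i => (hγ i).2.2⟩
  choose γ hγU hγg using hγ
  have hsmall : ∀ i, ∀ ε > 0, ∃ n, i ≤ n ∧ k n = i ∧
      (∀ x ∈ (U n).1 i, ∀ y ∈ (U n).1 i, dist x y ≤ ε) := by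
    intro i ε hε
    obtain ⟨N, hN⟩ := exists_nat_one_div_lt hε
    have hle : i ≤ Nat.pair i N := Nat.left_le_pair i N
    have hkl : k (Nat.pair i N) = i := by simp [k]
    have hlt : Nat.pair i N < Nat.pair i (N + 1 + Nat.pair i N) :=
      Nat.pair_lt_pair_right i (by omega)
    refine ⟨Nat.pair i (N + 1 + Nat.pair i N), Nat.left_le_pair _ _, by simp [k],
      fun x hx y hy => ?_⟩
    have hsub := hmono (i := i) (n := Nat.pair i N + 1) (by omega) hlt
    have := (hnext (Nat.pair i N) (U (Nat.pair i N))).2.2.1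
    rw [hkl, ← hU] at this
    refine (this x (hsub hx) y (hsub hy)).trans (le_trans ?_ hN.le)
    have : N ≤ Nat.pair i N := Nat.right_le_pair i N
    gcongr
  have hcauchy : ∀ i, CauchySeq fun n => γ n i := by
    intro i
    rw [Metric.cauchySeq_iff']
    intro ε hε
    obtain ⟨n, hin, -, hd⟩ := hsmall i (ε / 2) (half_pos hε)
    refine ⟨n, fun m hm => (hd _ (hmono hin hm (hγU m i)) _ (hγU n i)).trans_lt (half_lt_self hε)⟩
  choose z hz using fun i => cauchySeq_tendsto_of_complete (hcauchy i)
  have hzU : ∀ {i n}, i ≤ n → z i ∈ closure ((U n).1 i) := fun {i n} hin =>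
    mem_closure_of_tendsto (hz i) ((eventually_ge_atTop n).mono fun m hm =>
      hmono hin hm (hγU m i))
  have hgz : ∀ i, g (z i) = g (z 0) := fun i =>
    tendsto_nhds_unique ((hg.tendsto (z i)).comp (hz i)) <|
      ((hg.tendsto (z 0)).comp (hz 0)).congr fun n => (hγg n i).symm
  have hpre : Preperfect (range z) := by
    rintro _ ⟨i, rfl⟩
    rw [accPt_iff_nhds]
    intro V hV
    obtain ⟨ε, hε, hεV⟩ := Metric.mem_nhds_iff.1 hV
    obtain ⟨n, hin, hkn', hd⟩ := hsmall i (ε / 2) (half_pos hε)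
    obtain ⟨-, h2, -, h4⟩ := hnext n (U n)
    rw [hkn', ← hU] at h2 h4
    have hz1 : z (n + 1) ∈ closure ((U (n + 1)).1 (n + 1)) := hzU (le_refl (n + 1))
    have hdist : dist (z (n + 1)) (z i) ≤ ε / 2 := by
      have hsub : closure ((U n).1 i) ×ˢ closure ((U n).1 i) ⊆
          {p : Z × Z | dist p.1 p.2 ≤ ε / 2} := by
        rw [← closure_prod_eq]
        exact closure_minimal (fun p hp => hd _ hp.1 _ hp.2)
          (isClosed_le continuous_dist continuous_const)
      exact hsub (mk_mem_prod (closure_mono h2 hz1) (hzU hin))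
    refine ⟨z (n + 1), ⟨hεV (Metric.mem_ball.2 (by linarith)), mem_range_self _⟩, fun he => ?_⟩
    exact disjoint_left.1 h4 (hzU (hin.trans n.le_succ)) (he ▸ hz1)
  refine ⟨g (z 0), fun hc => ?_⟩
  have hsub : closure (range z) ⊆ g ⁻¹' {g (z 0)} := by
    refine closure_minimal ?_ (isClosed_singleton.preimage hg)
    rintro _ ⟨i, rfl⟩
    exact hgz i
  obtain ⟨φ, hφ, -, hφi⟩ := hpre.perfect_closure.exists_nat_bool_injection
    ((range_nonempty z).closure)
  have hcount : (range φ).Countable := (hc.mono hsub).mono hφ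
  have : Countable (ℕ → Bool) := by
    have := hcount.to_subtype
    exact (rangeFactorization_injective.2 hφi).countable
  obtain ⟨e, he⟩ := exists_surjective_nat (ℕ → Bool)
  obtain ⟨n, hn⟩ := he fun n => !e n n
  simpa using congrFun hn n

/-- **Lusin–Novikov**: the range of a countable-to-one Borel map between standard Borel spaces
is Borel. -/
theorem Measurable.measurableSet_range_of_countable_fibers {Z Y : Type*}
    [mZ : MeasurableSpace Z] [StandardBorelSpace Z] [MeasurableSpace Y] [StandardBorelSpace Y]
    {g : Z → Y} (hg : Measurable g) (hc : ∀ y, (g ⁻¹' {y}).Countable) :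
    MeasurableSet (range g) := by
  let := upgradeStandardBorel Y
  obtain ⟨tZ, hbZ, hpZ⟩ := StandardBorelSpace.polish (α := Z)
  obtain ⟨t, htle, hgt, ht⟩ := hg.exists_continuous
  have hb : @BorelSpace Z t mZ := @BorelSpace.mk _ t mZ <|
    hbZ.measurable_eq.trans (borel_eq_borel_of_le ht hpZ htle).symm
  clear htle hbZ hpZ tZ
  obtain ⟨m, rfl, hm⟩ := IsCompletelyMetrizableSpace.complete (X := Z)
  have hsmall : ¬ FiberLarge g fun _ => univ := fun h =>
    let ⟨y, hy⟩ := h.exists_not_countable_fiber hgt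
    hy (hc y)
  unfold FiberLarge at hsmall
  push Not at hsmall
  obtain ⟨𝓑, h𝓑c, h𝓑, hno⟩ := hsmall
  have hcover : ⋃₀ 𝓑 = univ := by
    refine eq_univ_of_forall fun z => ?_
    by_contra hz
    obtain ⟨i, hi⟩ := hno fun _ => z
    exact hi (mem_univ _) hz rfl
  rw [← image_univ, ← hcover, sUnion_eq_biUnion, image_iUnion₂]
  exact MeasurableSet.biUnion h𝓑c fun B hB =>
    (h𝓑 B hB).1.image_of_measurable_injOn hg (h𝓑 B hB).2

end CountableToOne

/-- the image of a Borel set under a countable-to-one Borel function between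
quotient Borel spaces is Borel. -/
theorem stmt_6 {X Y : Type} [MeasurableSpace X] [StandardBorelSpace X]
    [MeasurableSpace Y] [StandardBorelSpace Y]
    (E : Setoid X) (hE : CBER E) (F : Setoid Y) (hF : CBER F)
    (f : Quotient E → Quotient F) (hfB : QBorelFun E F f)
    (hfc : ∀ q : Quotient F, (f ⁻¹' {q}).Countable)
    (A : Set (Quotient E)) (hA : QBorelSet E A) :
    QBorelSet F (f '' A) := by
  let P : Set (X × Y) := {p | Quotient.mk E p.1 ∈ A ∧ f (Quotient.mk E p.1) = Quotient.mk F p.2}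
  have hP : MeasurableSet P := (measurable_fst hA).inter hfB
  have hclass : ∀ q : Quotient E, (Quotient.mk E ⁻¹' {q}).Countable := by
    intro q
    induction q using Quotient.inductionOn with
    | h x => exact (hE.2 x).mono fun y hy => Setoid.symm' E (Quotient.exact hy)
  have := hP.standardBorel
  have hrange : MeasurableSet (range fun p : P => p.1.2) := by
    refine (measurable_snd.comp measurable_subtype_coe).measurableSet_range_of_countable_fibers
      fun y => ?_
    have hX : (⋃ q ∈ f ⁻¹' {Quotient.mk F y}, Quotient.mk E ⁻¹' {q}).Countable :=
      (hfc _).biUnion fun q _ => hclass q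
    refine countable_of_injective_of_countable_image (f := fun p : P => p.1.1) ?_ (hX.mono ?_)
    · rintro ⟨⟨x, y₁⟩, h₁⟩ hy₁ ⟨⟨x', y₂⟩, h₂⟩ hy₂ (rfl : x = x')
      obtain rfl : y₁ = y := hy₁
      obtain rfl : y₂ = y₁ := hy₂
      rfl
    · rintro _ ⟨⟨⟨x, y₁⟩, h₁⟩, hy₁, rfl⟩
      obtain rfl : y₁ = y := hy₁
      simpa using h₁.2
  unfold QBorelSet
  convert hrange using 1
  ext y
  constructor
  · rintro ⟨q, hq, hqy⟩
    induction q using Quotient.inductionOn with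
    | h x => exact ⟨⟨(x, y), hq, hqy⟩, rfl⟩
  · rintro ⟨⟨⟨x, y⟩, hx, hxy⟩, rfl⟩
    exact ⟨_, hx, hxy⟩
end

section
/- (Existence of liftings) Let X, Y be standard Borel spaces and E, F countable Borel equivalence relations on X, Y. A function f : X/E → Y/F is Borel (its graph pulled back to X×Y is Borel) if and only if there exists a Borel function f̃ : X → Y with π_F ∘ f̃ = f ∘ π_E. -/
open MeasureTheory Set

/-- `A` is covered by countably many measurable sets on each of which `p` is injective. -/
def CountablyInjective {P X : Type*} [MeasurableSpace P] (p : P → X) (A : Set P) : Prop :=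
  ∃ D : ℕ → Set P, (∀ n, MeasurableSet (D n)) ∧ (∀ n, InjOn p (D n)) ∧ A ⊆ ⋃ n, D n

namespace CountablyInjective

variable {P X : Type*} [MeasurableSpace P] {p : P → X}

lemma mono {A A' : Set P} (h : CountablyInjective p A) (hA : A' ⊆ A) :
    CountablyInjective p A' := by
  obtain ⟨D, hD, hp, hc⟩ := h
  exact ⟨D, hD, hp, hA.trans hc⟩

lemma of_injOn {A : Set P} (hA : MeasurableSet A) (hp : InjOn p A) : CountablyInjective p A :=
  ⟨fun _ => A, fun _ => hA, fun _ => hp, fun _ hx => mem_iUnion.2 ⟨0, hx⟩⟩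

lemma empty : CountablyInjective p (∅ : Set P) :=
  of_injOn MeasurableSet.empty (by simp)

lemma iUnion {τ : Type*} [Countable τ] {A : τ → Set P} (h : ∀ t, CountablyInjective p (A t)) :
    CountablyInjective p (⋃ t, A t) := by
  rcases isEmpty_or_nonempty τ with hτ | hτ
  · simpa using empty
  obtain ⟨e, he⟩ := exists_surjective_nat τ
  choose D hD hp hc using h
  refine ⟨fun n => D (e n.unpair.1) n.unpair.2, fun n => hD _ _, fun n => hp _ _, ?_⟩
  refine iUnion_subset fun t x hx => ?_
  obtain ⟨m, hm⟩ := mem_iUnion.1 (hc t hx)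
  obtain ⟨k, rfl⟩ := he t
  exact mem_iUnion.2 ⟨Nat.pair k m, by simpa using hm⟩

lemma union {A B : Set P} (hA : CountablyInjective p A) (hB : CountablyInjective p B) :
    CountablyInjective p (A ∪ B) := by
  rw [union_eq_iUnion]
  exact iUnion fun b => by cases b <;> assumption

end CountablyInjective

/-- A family of sets is large if, for every measurable cover of the base indexed in the same way,
some member restricted to the corresponding piece of the cover is not countably injective. -/
def LargeFamily {P X ι : Type*} [MeasurableSpace P] [MeasurableSpace X] (p : P → X)
    (A : ι → Set P) : Prop :=
  ∀ B : ι → Set X, (∀ i, MeasurableSet (B i)) → ⋃ i, B i = univ →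
    ∃ i, ¬ CountablyInjective p (A i ∩ p ⁻¹' B i)

namespace LargeFamily

variable {P X ι : Type*} [MeasurableSpace P] [MeasurableSpace X] {p : P → X} {A : ι → Set P}

lemma nonempty (hA : LargeFamily p A) (i : ι) : (A i).Nonempty := by
  classical
  by_contra h
  rw [not_nonempty_iff_eq_empty] at h
  obtain ⟨k, hk⟩ := hA (fun k => if k = i then univ else ∅)
    (fun k => by split_ifs <;> simp)
    (eq_univ_of_forall fun x => mem_iUnion.2 ⟨i, by simp⟩)
  apply hk
  by_cases hki : k = i
  · subst hki
    simpa [h] using CountablyInjective.empty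
  · simpa [hki] using CountablyInjective.empty

/-- Members of a large family cannot lie over disjoint measurable sets. -/
lemma not_disjoint (hA : LargeFamily p A) {i j : ι} {U V : Set X} (hU : MeasurableSet U)
    (hV : MeasurableSet V) (hUV : Disjoint U V) (hi : A i ⊆ p ⁻¹' U) (hj : A j ⊆ p ⁻¹' V) :
    False := by
  classical
  obtain ⟨k, hk⟩ := hA (fun k => (if k = i then Uᶜ else ∅) ∪ (if k = j then Vᶜ else ∅))
    (fun k => by split_ifs <;> measurability)
    (eq_univ_of_forall fun x => by
      by_cases hx : x ∈ U
      · exact mem_iUnion.2 ⟨j, Or.inr (by simpa using disjoint_left.1 hUV hx)⟩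
      · exact mem_iUnion.2 ⟨i, Or.inl (by simpa using hx)⟩)
  apply hk
  refine CountablyInjective.empty.mono ?_
  rintro y ⟨hy, hy' | hy'⟩
  · split_ifs at hy' with h
    · subst h
      exact hy' (hi hy)
    · exact hy'
  · split_ifs at hy' with h
    · subst h
      exact hy' (hj hy)
    · exact hy'

lemma comp {κ : Type*} [Countable κ] (hA : LargeFamily p A) (f : κ → ι) :
    LargeFamily p (fun k => A (f k)) := by
  intro B hB hc
  by_contra! h
  obtain ⟨i, hi⟩ := hA (fun i => ⋃ k : {k // f k = i}, B k) (fun i => .iUnion fun k => hB _)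
    (eq_univ_of_forall fun x => by
      obtain ⟨k, hk⟩ := mem_iUnion.1 (hc ▸ mem_univ x)
      exact mem_iUnion.2 ⟨f k, mem_iUnion.2 ⟨⟨k, rfl⟩, hk⟩⟩)
  apply hi
  rw [preimage_iUnion, inter_iUnion]
  exact CountablyInjective.iUnion fun k => by simpa [k.2] using h k

open Classical in
lemma exists_update_inter {τ : Type*} [Countable τ] [Countable ι] (hA : LargeFamily p A) (i : ι)
    {C : τ → Set P} (hC : ⋃ t, C t = univ) :
    ∃ t, LargeFamily p (Function.update A i (A i ∩ C t)) := by
  by_contra! h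
  simp only [LargeFamily] at h
  push Not at h
  choose B hB hc hs using h
  let V : Set X := (⋃ t, ⋃ k : {k // k ≠ i}, B t k)ᶜ
  have hV : MeasurableSet V := (MeasurableSet.iUnion fun t => .iUnion fun k => hB t _).compl
  obtain ⟨k, hk⟩ := hA (fun k => if k = i then V else ⋃ t, B t k)
    (fun k => by
      split_ifs
      · exact hV
      · exact .iUnion fun t => hB t _)
    (eq_univ_of_forall fun x => by
      by_cases hx : x ∈ V
      · exact mem_iUnion.2 ⟨i, by simpa using hx⟩
      · simp only [V, notMem_compl_iff, mem_iUnion] at hx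
        obtain ⟨t, ⟨k, hk⟩, hx⟩ := hx
        refine mem_iUnion.2 ⟨k, ?_⟩
        rw [if_neg hk]
        exact mem_iUnion.2 ⟨t, hx⟩)
  apply hk
  by_cases hki : k = i
  · subst hki
    rw [if_pos rfl]
    refine (CountablyInjective.iUnion fun t => hs t k).mono ?_
    rintro y ⟨hy, hyV⟩
    obtain ⟨t, ht⟩ := mem_iUnion.1 (hC ▸ mem_univ y)
    obtain ⟨l, hl⟩ := mem_iUnion.1 (hc t ▸ mem_univ (p y))
    have hlk : l = k := by
      by_contra hlk
      exact hyV (mem_iUnion.2 ⟨t, mem_iUnion.2 ⟨⟨l, hlk⟩, hl⟩⟩)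
    subst hlk
    exact mem_iUnion.2 ⟨t, by simpa using ⟨⟨hy, ht⟩, hl⟩⟩
  · rw [if_neg hki, preimage_iUnion, inter_iUnion]
    exact CountablyInjective.iUnion fun t => by simpa [hki] using hs t k

open Classical in
lemma exists_update_split {τ : Type*} [Countable τ] [Countable ι] (hp : Measurable p)
    (hA : LargeFamily p A) {i j : ι} (hij : i ≠ j) (hAij : A i = A j) (hi : MeasurableSet (A i))
    {C : τ → Set P} (hCm : ∀ t, MeasurableSet (C t))
    (hC : ∀ y y', y ≠ y' → ∃ s t, y ∈ C s ∧ y' ∈ C t ∧ Disjoint (C s) (C t)) :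
    ∃ s t, Disjoint (C s) (C t) ∧
      LargeFamily p (Function.update (Function.update A i (A i ∩ C s)) j (A j ∩ C t)) := by
  by_contra! h
  simp only [LargeFamily] at h
  push Not at h
  replace h := fun q : {q : τ × τ // Disjoint (C q.1) (C q.2)} => h q.1.1 q.1.2 q.2
  choose B hB hc hs using h
  let V : Set X := (⋃ q, ⋃ k : {k // k ≠ i ∧ k ≠ j}, B q k)ᶜ
  have hV : MeasurableSet V := (MeasurableSet.iUnion fun t => .iUnion fun k => hB t _).compl
  obtain ⟨k, hk⟩ := hA (fun k => if k = i then V else if k = j then ∅ else ⋃ q, B q k)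
    (fun k => by
      split_ifs
      · exact hV
      · exact .empty
      · exact .iUnion fun t => hB t _)
    (eq_univ_of_forall fun x => by
      by_cases hx : x ∈ V
      · exact mem_iUnion.2 ⟨i, by simpa using hx⟩
      · simp only [V, notMem_compl_iff, mem_iUnion] at hx
        obtain ⟨t, ⟨k, hk⟩, hx⟩ := hx
        refine mem_iUnion.2 ⟨k, ?_⟩
        rw [if_neg hk.1, if_neg hk.2]
        exact mem_iUnion.2 ⟨t, hx⟩)
  apply hk
  by_cases hki : k = i
  · subst hki
    rw [if_pos rfl]
    let S : Set P := (⋃ q, C q.1.1 ∩ p ⁻¹' B q k) ∪ ⋃ q, C q.1.2 ∩ p ⁻¹' B q j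
    have hS : MeasurableSet S :=
      (MeasurableSet.iUnion fun q => (hCm _).inter (hp (hB _ _))).union
        (MeasurableSet.iUnion fun q => (hCm _).inter (hp (hB _ _)))
    have hrest : CountablyInjective p ((A k ∩ p ⁻¹' V) \ S) := by
      refine .of_injOn ((hi.inter (hp hV)).diff hS) ?_
      rintro y ⟨⟨-, hyV⟩, hyS⟩ y' ⟨-, hyS'⟩ hyy
      by_contra hne
      obtain ⟨s, t, hys, ht, hd⟩ := hC y y' hne
      obtain ⟨l, hl⟩ := mem_iUnion.1 (hc ⟨(s, t), hd⟩ ▸ mem_univ (p y))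
      by_cases hlk : l = k
      · subst hlk
        exact hyS (Or.inl (mem_iUnion.2 ⟨⟨(s, t), hd⟩, hys, hl⟩))
      · by_cases hlj : l = j
        · subst hlj
          refine hyS' (Or.inr (mem_iUnion.2 ⟨⟨(s, t), hd⟩, ht, ?_⟩))
          rwa [mem_preimage, ← hyy]
        · exact hyV (mem_iUnion.2 ⟨⟨(s, t), hd⟩, mem_iUnion.2 ⟨⟨l, hlk, hlj⟩, hl⟩⟩)
    refine ((CountablyInjective.iUnion fun q => hs q k).union
      ((CountablyInjective.iUnion fun q => hs q j).union hrest)).mono ?_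
    intro y hy
    by_cases hyS : y ∈ S
    · rcases hyS with hyS | hyS
      · obtain ⟨q, hq⟩ := mem_iUnion.1 hyS
        exact Or.inl (mem_iUnion.2 ⟨q, by simpa [hij] using ⟨⟨hy.1, hq.1⟩, hq.2⟩⟩)
      · obtain ⟨q, hq⟩ := mem_iUnion.1 hyS
        exact Or.inr (Or.inl (mem_iUnion.2
          ⟨q, by simpa using ⟨⟨hAij ▸ hy.1, hq.1⟩, hq.2⟩⟩))
    · exact Or.inr (Or.inr ⟨hy, hyS⟩)
  · by_cases hkj : k = j
    · rw [if_neg hki, if_pos hkj]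
      simpa using CountablyInjective.empty
    · rw [if_neg hki, if_neg hkj, preimage_iUnion, inter_iUnion]
      exact CountablyInjective.iUnion fun t => by simpa [hki, hkj] using hs t k

lemma exists_refine {τ : Type*} [Countable τ] [Finite ι]
    (hA : LargeFamily p A) (hAm : ∀ i, MeasurableSet (A i))
    {C : τ → Set P} (hCm : ∀ t, MeasurableSet (C t)) (hC : ⋃ t, C t = univ) :
    ∃ A' : ι → Set P, LargeFamily p A' ∧ (∀ i, MeasurableSet (A' i)) ∧ (∀ i, A' i ⊆ A i) ∧
      ∀ i, ∃ t, A' i ⊆ C t := by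
  classical
  have := Fintype.ofFinite ι
  suffices H : ∀ S : Finset ι, ∃ A' : ι → Set P, LargeFamily p A' ∧
      (∀ i, MeasurableSet (A' i)) ∧ (∀ i, A' i ⊆ A i) ∧ ∀ i ∈ S, ∃ t, A' i ⊆ C t by
    simpa using H Finset.univ
  intro S
  induction S using Finset.induction_on with
  | empty => exact ⟨A, hA, hAm, fun _ => Subset.rfl, by simp⟩
  | insert i S _ ih =>
    obtain ⟨A', hL, hm, hsub, hS⟩ := ih
    obtain ⟨t, ht⟩ := hL.exists_update_inter i hC
    have hle : ∀ k, Function.update A' i (A' i ∩ C t) k ⊆ A' k := by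
      intro k
      by_cases hk : k = i
      · subst hk
        simp
      · simp [hk]
    refine ⟨_, by convert! ht, fun k => ?_, fun k => (hle k).trans (hsub k), fun k hk => ?_⟩
    · by_cases hk : k = i
      · subst hk
        simpa using (hm k).inter (hCm t)
      · simpa [hk] using hm k
    · by_cases hki : k = i
      · subst hki
        exact ⟨t, by simp⟩
      · obtain ⟨s, hs⟩ := hS k (Finset.mem_of_mem_insert_of_ne hk hki)
        exact ⟨s, (hle k).trans hs⟩

lemma exists_split {τ : Type*} [Countable τ] [Finite ι] (hp : Measurable p)
    (hA : LargeFamily p A) (hAm : ∀ i, MeasurableSet (A i))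
    {C : τ → Set P} (hCm : ∀ t, MeasurableSet (C t))
    (hC : ∀ y y', y ≠ y' → ∃ s t, y ∈ C s ∧ y' ∈ C t ∧ Disjoint (C s) (C t)) :
    ∃ A' : ι × Bool → Set P, LargeFamily p A' ∧ (∀ k, MeasurableSet (A' k)) ∧
      (∀ k, A' k ⊆ A k.1) ∧
      ∀ i, ∃ s t, Disjoint (C s) (C t) ∧ A' (i, false) ⊆ C s ∧ A' (i, true) ⊆ C t := by
  classical
  have := Fintype.ofFinite ι
  suffices H : ∀ S : Finset ι, ∃ A' : ι × Bool → Set P, LargeFamily p A' ∧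
      (∀ k, MeasurableSet (A' k)) ∧ (∀ k, A' k ⊆ A k.1) ∧
      (∀ i ∈ S, ∃ s t, Disjoint (C s) (C t) ∧ A' (i, false) ⊆ C s ∧ A' (i, true) ⊆ C t) ∧
      ∀ i ∉ S, ∀ b, A' (i, b) = A i by
    simpa using H Finset.univ
  intro S
  induction S using Finset.induction_on with
  | empty => exact ⟨_, hA.comp Prod.fst, fun _ => hAm _, fun _ => Subset.rfl, by simp, by simp⟩
  | insert i S hiS ih =>
    obtain ⟨A', hL, hm, hsub, hS, hS'⟩ := ih
    obtain ⟨s, t, hd, hst⟩ := hL.exists_update_split hp (i := (i, false)) (j := (i, true))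
      (by simp) (by rw [hS' i hiS, hS' i hiS]) (hm _) hCm hC
    refine ⟨_, by convert! hst, ?_, ?_, ?_, ?_⟩
    · rintro ⟨k, b⟩
      by_cases hk : k = i
      · subst hk
        cases b
        · simpa using (hm _).inter (hCm s)
        · simpa using (hm _).inter (hCm t)
      · simpa [hk] using hm (k, b)
    · rintro ⟨k, b⟩
      by_cases hk : k = i
      · subst hk
        cases b
        · simpa using inter_subset_left.trans (hsub (k, false))
        · simpa using inter_subset_left.trans (hsub (k, true))
      · simpa [hk] using hsub (k, b)
    · intro k hk
      by_cases hki : k = i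
      · subst hki
        exact ⟨s, t, hd, by simp, by simp⟩
      · simpa [hki] using hS k (Finset.mem_of_mem_insert_of_ne hk hki)
    · intro k hk b
      rw [Finset.mem_insert, not_or] at hk
      simpa [hk.1] using hS' k hk.2 b

end LargeFamily

/-- One step of the construction of a perfect tree of large sets. -/
lemma LargeFamily.exists_succ {P X : Type*} [MetricSpace P] [SecondCountableTopology P]
    [MeasurableSpace P] [BorelSpace P] [MeasurableSpace X] {p : P → X} (hp : Measurable p)
    {n : ℕ} {A : (Fin n → Bool) → Set P} (hA : LargeFamily p A)
    (hAm : ∀ s, MeasurableSet (A s)) :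
    ∃ A' : (Fin (n + 1) → Bool) → Set P, LargeFamily p A' ∧ (∀ s, MeasurableSet (A' s)) ∧
      (∀ s, A' s ⊆ A (Fin.init s)) ∧
      (∀ s, ∃ x, A' s ⊆ Metric.closedBall x (1 / (n + 1 : ℝ))) ∧
      ∀ s t, Fin.init s = Fin.init t → s (Fin.last n) = false → t (Fin.last n) = true →
        Disjoint (closure (A' s)) (closure (A' t)) := by
  have : Nonempty P := ⟨(hA.nonempty fun _ => false).some⟩
  let C : ℕ × ℕ → Set P := fun q =>
    Metric.closedBall (TopologicalSpace.denseSeq P q.1) (1 / (q.2 + 1 : ℝ))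
  have hCc : ∀ q, IsClosed (C q) := fun q => Metric.isClosed_closedBall
  have hdense : ∀ (y : P) (m : ℕ), ∃ k, y ∈ C (k, m) := by
    intro y m
    obtain ⟨k, hk⟩ := (TopologicalSpace.denseRange_denseSeq P).exists_dist_lt y
      (Nat.one_div_pos_of_nat (α := ℝ) (n := m))
    exact ⟨k, hk.le⟩
  obtain ⟨A₁, hL₁, hm₁, hsub₁, hd₁⟩ := hA.exists_split hp hAm (C := C)
    (fun q => (hCc q).measurableSet) (by
      intro y y' hne
      obtain ⟨m, hm⟩ := exists_nat_one_div_lt (show 0 < dist y y' / 4 by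
        have := dist_pos.2 hne
        positivity)
      obtain ⟨k, hk⟩ := hdense y m
      obtain ⟨k', hk'⟩ := hdense y' m
      refine ⟨_, _, hk, hk', Metric.closedBall_disjoint_closedBall ?_⟩
      rw [Metric.mem_closedBall] at hk hk'
      have h₁ := dist_triangle4 y (TopologicalSpace.denseSeq P k)
        (TopologicalSpace.denseSeq P k') y'
      rw [dist_comm (TopologicalSpace.denseSeq P k') y'] at h₁
      dsimp only at hk hk' ⊢
      linarith)
  obtain ⟨A₂, hL₂, hm₂, hsub₂, hb₂⟩ :=
    (hL₁.comp (fun s : Fin (n + 1) → Bool => (Fin.init s, s (Fin.last n)))).exists_refine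
      (fun _ => hm₁ _) (C := fun k => C (k, n)) (fun q => (hCc _).measurableSet)
      (eq_univ_of_forall fun y => mem_iUnion.2 (hdense y n))
  refine ⟨A₂, hL₂, hm₂, fun s => (hsub₂ s).trans (hsub₁ _), fun s => ?_, ?_⟩
  · obtain ⟨k, hk⟩ := hb₂ s
    exact ⟨_, hk⟩
  · intro s t hst hs ht
    obtain ⟨q, q', hd, h, h'⟩ := hd₁ (Fin.init s)
    refine hd.mono (closure_minimal ?_ (hCc q)) (closure_minimal ?_ (hCc q'))
    · refine (hsub₂ s).trans ?_
      simpa [hs] using h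
    · refine (hsub₂ t).trans ?_
      simpa [ht, ← hst] using h'

/-- A continuous countable-to-one map on a Polish space is injective on each piece of a countable
cover by Borel sets. -/
lemma countablyInjective_univ_of_continuous {P X : Type*} [MetricSpace P] [CompleteSpace P]
    [SecondCountableTopology P] [MeasurableSpace P] [BorelSpace P] [TopologicalSpace X] [T2Space X]
    [MeasurableSpace X] [BorelSpace X] {p : P → X} (hp : Continuous p) (hpm : Measurable p)
    (hcount : ∀ x, (p ⁻¹' {x}).Countable) : CountablyInjective p univ := by
  by_contra hnot
  let G : ℕ → Type _ := fun n =>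
    {A : (Fin n → Bool) → Set P // LargeFamily p A ∧ ∀ s, MeasurableSet (A s)}
  let T₀ : G 0 := ⟨fun _ => univ, fun B hB hc => ⟨Fin.elim0, by
    have : B Fin.elim0 = univ := by
      rw [← hc]
      exact subset_antisymm (subset_iUnion B _)
        (iUnion_subset fun i => (congrArg B (Subsingleton.elim i _)).subset)
    simpa [this] using hnot⟩, fun _ => .univ⟩
  choose A' hL hm hsub hball hdisj using
    fun (n : ℕ) (A : G n) => LargeFamily.exists_succ hpm A.2.1 A.2.2
  let T : ∀ n, G n := fun n =>
    Nat.rec (motive := G) T₀ (fun n A => ⟨A' n A, hL n A, hm n A⟩) n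
  let K : ℕ → (ℕ → Bool) → Set P := fun n a => (T n).1 fun i => a i
  have hKsucc : ∀ n a, K (n + 1) a ⊆ K n a := fun n a => hsub n (T n) _
  have hKanti : ∀ a, Antitone fun n => K n a := fun a => antitone_nat_of_succ_le (hKsucc · a)
  have hKball : ∀ n a, ∃ x, K (n + 1) a ⊆ Metric.closedBall x (1 / (n + 1 : ℝ)) :=
    fun n a => hball n (T n) _
  have hne : ∀ n a, (K n a).Nonempty := fun n a => (T n).2.1.nonempty _
  choose w hw using hne
  have hlim : ∀ a, ∃ z, Filter.Tendsto (fun n => w (n + 1) a) Filter.atTop (nhds z) := by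
    intro a
    refine cauchySeq_tendsto_of_complete
      (cauchySeq_of_le_tendsto_0 (fun n : ℕ => 2 * (1 / (n + 1 : ℝ))) ?_ ?_)
    · intro m k N hNm hNk
      obtain ⟨x, hx⟩ := hKball N a
      have h₁ := hx (hKanti a (Nat.succ_le_succ hNm) (hw (m + 1) a))
      have h₂ := hx (hKanti a (Nat.succ_le_succ hNk) (hw (k + 1) a))
      rw [Metric.mem_closedBall] at h₁ h₂
      have := dist_triangle_right (w (m + 1) a) (w (k + 1) a) x
      linarith
    · simpa using (tendsto_one_div_add_atTop_nhds_zero_nat (𝕜 := ℝ)).const_mul 2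
  choose z hz using hlim
  have hzK : ∀ n a, z a ∈ closure (K n a) := by
    intro n a
    refine mem_closure_of_tendsto (hz a) (Filter.eventually_atTop.2 ⟨n, fun m hmn => ?_⟩)
    exact hKanti a (hmn.trans (Nat.le_succ m)) (hw (m + 1) a)
  have hev : ∀ a (W : Set P), IsOpen W → z a ∈ W → ∃ N, ∀ n ≥ N, K n a ⊆ W := by
    intro a W hW hzW
    obtain ⟨ε, hε, hεW⟩ := Metric.isOpen_iff.1 hW _ hzW
    obtain ⟨N, hN⟩ := exists_nat_one_div_lt (show 0 < ε / 2 by positivity)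
    refine ⟨N + 1, fun n hn y hy => hεW ?_⟩
    obtain ⟨x, hx⟩ := hKball N a
    have h₁ := hx (hKanti a hn hy)
    have h₂ := closure_minimal hx Metric.isClosed_closedBall (hzK (N + 1) a)
    rw [Metric.mem_closedBall] at h₁ h₂
    rw [Metric.mem_ball]
    have := dist_triangle_right y (z a) x
    linarith
  have hfibre : ∀ a b, p (z a) = p (z b) := by
    intro a b
    by_contra hab
    obtain ⟨U, V, hU, hV, haU, hbV, hUV⟩ := t2_separation hab
    obtain ⟨N, hN⟩ := hev a _ (hU.preimage hp) haU
    obtain ⟨M, hM⟩ := hev b _ (hV.preimage hp) hbV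
    exact (T (max N M)).2.1.not_disjoint hU.measurableSet hV.measurableSet hUV
      (hN _ (le_max_left _ _)) (hM _ (le_max_right _ _))
  have hsep : ∀ (n : ℕ) (a b : ℕ → Bool), (∀ i < n, a i = b i) → a n = false → b n = true →
      z a ≠ z b := by
    intro n a b hab ha hb hzab
    have hd := hdisj n (T n) (fun i => a i) (fun i => b i)
      (funext fun i => hab i i.2) ha hb
    exact disjoint_left.1 hd (hzK (n + 1) a) (hzab ▸ hzK (n + 1) b)
  have hinj : Function.Injective z := by
    intro a b hzab
    by_contra hab
    have hlt : ∀ i < PiNat.firstDiff a b, a i = b i :=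
      fun i hi => PiNat.apply_eq_of_lt_firstDiff hi
    have hne := PiNat.apply_firstDiff_ne hab
    cases ha : a (PiNat.firstDiff a b) <;> cases hb : b (PiNat.firstDiff a b)
    · exact hne (ha.trans hb.symm)
    · exact hsep _ a b hlt ha hb hzab
    · exact hsep _ b a (fun i hi => (hlt i hi).symm) hb ha hzab.symm
    · exact hne (ha.trans hb.symm)
  have hcR : (range z).Countable :=
    (hcount (p (z fun _ => false))).mono (by
      rintro _ ⟨a, rfl⟩
      exact hfibre a _)
  have : Countable (range z) := hcR.to_subtype
  have : Countable (ℕ → Bool) := (rangeFactorization_injective.2 hinj).countable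
  obtain ⟨e, he⟩ := exists_surjective_nat (ℕ → Bool)
  obtain ⟨n, hn⟩ := he fun n => !(e n n)
  simpa using congrFun hn n

/-- **Lusin–Novikov**: a countable-to-one Borel map between standard Borel spaces is injective on
each piece of a countable cover by Borel sets. -/
theorem countablyInjective_univ {P X : Type*} [MeasurableSpace P] [StandardBorelSpace P]
    [MeasurableSpace X] [StandardBorelSpace X] {p : P → X} (hp : Measurable p)
    (hcount : ∀ x, (p ⁻¹' {x}).Countable) : CountablyInjective p univ := by
  obtain ⟨τ, hτb, hτp⟩ := ‹StandardBorelSpace P›.polish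
  obtain ⟨τX, _, _⟩ := ‹StandardBorelSpace X›.polish
  obtain ⟨τ', hle, hcont, hpol⟩ := hp.exists_continuous
  have hb : @BorelSpace P τ' _ :=
    @BorelSpace.mk P τ' _ (hτb.measurable_eq.trans (borel_eq_borel_of_le hpol hτp hle).symm)
  clear hle hτp hτb
  let := τ'
  let := TopologicalSpace.upgradeIsCompletelyMetrizable P
  exact countablyInjective_univ_of_continuous hcont hp hcount

/-- A countable-to-one surjective Borel map between standard Borel spaces has a Borel section. -/
theorem exists_measurable_rightInverse_of_countable_fibres {P X : Type*} [MeasurableSpace P]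
    [StandardBorelSpace P] [MeasurableSpace X] [StandardBorelSpace X] {p : P → X}
    (hp : Measurable p) (hcount : ∀ x, (p ⁻¹' {x}).Countable) (hsurj : Function.Surjective p) :
    ∃ g : X → P, Measurable g ∧ Function.RightInverse g p := by
  obtain ⟨D, hD, hinj, hc⟩ := countablyInjective_univ hp hcount
  have hpD : ∀ n, MeasurableSet (p '' D n) :=
    fun n => (hD n).image_of_measurable_injOn hp (hinj n)
  let Q : Set P := ⋃ n, D n \ p ⁻¹' ⋃ m : {m // m < n}, p '' D m
  have hQ : MeasurableSet Q :=
    .iUnion fun n => (hD n).diff (hp (.iUnion fun m => hpD m))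
  have hQinj : InjOn p Q := by
    intro y hy y' hy' hyy
    obtain ⟨n, hn, hn'⟩ := mem_iUnion.1 hy
    obtain ⟨m, hm, hm'⟩ := mem_iUnion.1 hy'
    rcases lt_trichotomy n m with h | rfl | h
    · exact (hm' (mem_iUnion.2 ⟨⟨n, h⟩, y, hn, hyy⟩)).elim
    · exact hinj n hn hm hyy
    · exact (hn' (mem_iUnion.2 ⟨⟨m, h⟩, y', hm, hyy.symm⟩)).elim
  have hQsurj : ∀ x, ∃ y ∈ Q, p y = x := by
    classical
    intro x
    have hex : ∃ n, x ∈ p '' D n := by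
      obtain ⟨y, rfl⟩ := hsurj x
      obtain ⟨n, hn⟩ := mem_iUnion.1 (hc (mem_univ y))
      exact ⟨n, y, hn, rfl⟩
    obtain ⟨y, hy, hyx⟩ := Nat.find_spec hex
    refine ⟨y, mem_iUnion.2 ⟨Nat.find hex, hy, fun hmem => ?_⟩, hyx⟩
    obtain ⟨⟨m, hm⟩, hmem⟩ := mem_iUnion.1 hmem
    exact Nat.find_min hex hm (hyx ▸ hmem)
  choose g hgQ hg using hQsurj
  refine ⟨g, fun S hS => ?_, hg⟩
  have heq : g ⁻¹' S = p '' (Q ∩ S) := by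
    ext x
    constructor
    · exact fun hx => ⟨g x, ⟨hgQ x, hx⟩, hg x⟩
    · rintro ⟨y, ⟨hyQ, hyS⟩, rfl⟩
      rw [mem_preimage, hQinj (hgQ (p y)) hyQ (hg (p y))]
      exact hyS
  rw [heq]
  exact (hQ.inter hS).image_of_measurable_injOn hp (hQinj.mono inter_subset_left)

/-- existence of liftings: a function between quotient Borel spaces is Borel iff
it admits a Borel lifting between the underlying standard Borel spaces. -/
theorem stmt_7 {X Y : Type} [MeasurableSpace X] [StandardBorelSpace X]
    [MeasurableSpace Y] [StandardBorelSpace Y]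
    (E : Setoid X) (hE : CBER E) (F : Setoid Y) (hF : CBER F)
    (f : Quotient E → Quotient F) :
    QBorelFun E F f ↔
      ∃ g : X → Y, Measurable g ∧ ∀ x : X, f (Quotient.mk E x) = Quotient.mk F (g x) := by
  constructor
  · intro hR
    have : StandardBorelSpace {q : X × Y | f (Quotient.mk E q.1) = Quotient.mk F q.2} :=
      MeasurableSet.standardBorel hR
    obtain ⟨g, hg, hgp⟩ := exists_measurable_rightInverse_of_countable_fibres
      (p := fun q : {q : X × Y | f (Quotient.mk E q.1) = Quotient.mk F q.2} => q.1.1)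
      (measurable_fst.comp measurable_subtype_coe)
      (by
        intro x
        obtain ⟨y₀, hy₀⟩ := Quotient.exists_rep (f (Quotient.mk E x))
        refine MapsTo.countable_of_injOn (f := fun q => q.1.2) (t := {y | F.r y₀ y}) ?_ ?_
          (hF.2 y₀)
        · rintro ⟨⟨x', y⟩, hq⟩ hx
          obtain rfl : x' = x := hx
          exact Quotient.exact (hy₀.trans hq)
        · rintro ⟨⟨x', y⟩, hq⟩ hx ⟨⟨x'', y'⟩, hq'⟩ hx' hyy
          obtain rfl : x' = x := hx
          obtain rfl : x'' = x' := hx'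
          obtain rfl : y = y' := hyy
          rfl)
      (by
        intro x
        obtain ⟨y₀, hy₀⟩ := Quotient.exists_rep (f (Quotient.mk E x))
        exact ⟨⟨(x, y₀), hy₀.symm⟩, rfl⟩)
    refine ⟨fun x => (g x).1.2, measurable_snd.comp (measurable_subtype_coe.comp hg), fun x => ?_⟩
    have h : f (Quotient.mk E (g x).1.1) = Quotient.mk F (g x).1.2 := (g x).2
    have hx : (g x).1.1 = x := hgp x
    rwa [hx] at h
  · rintro ⟨g, hg, hfg⟩
    have heq : {q : X × Y | f (Quotient.mk E q.1) = Quotient.mk F q.2} =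
        (fun q : X × Y => (g q.1, q.2)) ⁻¹' {q | F.r q.1 q.2} := by
      ext q
      simp only [mem_ofPred_eq, mem_preimage, hfg]
      exact Quotient.eq
    unfold QBorelFun
    rw [heq]
    exact ((hg.comp measurable_fst).prodMk measurable_snd) hF.1
end

section
/- Let (X,E) be a quotient Borel space and {f_n : n ∈ ℕ} a countable family of Borel endomorphisms of (X,E), each countable-to-one. Then the smallest equivalence relation F on X/E containing all the graphs f_n is a countable Borel equivalence relation (Borel as a subset of (X,E)²). -/
open MeasureTheory Set

/-- `s` is covered by countably many Borel sets on each of which `f` is injective. -/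
def CountablyInjOn {X Y : Type*} [MeasurableSpace Y] (f : Y → X) (s : Set Y) : Prop :=
  ∃ B : ℕ → Set Y, (∀ n, MeasurableSet (B n) ∧ InjOn f (B n)) ∧ s ⊆ ⋃ n, B n

namespace CountablyInjOn

variable {X Y : Type*} [MeasurableSpace Y] {f : Y → X} {s t : Set Y}

theorem mono (ht : CountablyInjOn f t) (hst : s ⊆ t) : CountablyInjOn f s :=
  let ⟨B, hB, htB⟩ := ht
  ⟨B, hB, hst.trans htB⟩

theorem of_injOn (hs : MeasurableSet s) (hf : InjOn f s) : CountablyInjOn f s :=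
  ⟨fun _ => s, fun _ => ⟨hs, hf⟩, fun _ hy => mem_iUnion.2 ⟨0, hy⟩⟩

theorem iUnion {κ : Type*} [Countable κ] {s : κ → Set Y} (hs : ∀ i, CountablyInjOn f (s i)) :
    CountablyInjOn f (⋃ i, s i) := by
  choose B hB hsB using hs
  cases isEmpty_or_nonempty κ
  · exact (of_injOn .empty (injOn_empty f)).mono (by simp)
  obtain ⟨e, he⟩ := exists_surjective_nat (κ × ℕ)
  refine ⟨fun n => B (e n).1 (e n).2, fun n => hB _ _, iUnion_subset fun i y hy => ?_⟩
  obtain ⟨m, hm⟩ := mem_iUnion.1 (hsB i hy)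
  obtain ⟨n, hn⟩ := he (i, m)
  exact mem_iUnion.2 ⟨n, by rwa [hn]⟩

theorem union (hs : CountablyInjOn f s) (ht : CountablyInjOn f t) : CountablyInjOn f (s ∪ t) := by
  rw [union_eq_iUnion]
  exact iUnion (by rintro (_ | _) <;> assumption)

end CountablyInjOn

/-- An analytic set on which a continuous function is injective is contained in a Borel set on
which that function is injective. -/
theorem MeasureTheory.AnalyticSet.exists_measurableSet_injOn {X Y : Type*}
    [TopologicalSpace X] [T2Space X]
    [TopologicalSpace Y] [PolishSpace Y] [MeasurableSpace Y] [BorelSpace Y]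
    {f : Y → X} (hf : Continuous f) {A : Set Y} (hA : AnalyticSet A) (hinj : InjOn f A) :
    ∃ B, A ⊆ B ∧ MeasurableSet B ∧ InjOn f B := by
  let N : Set Y → Set Y := fun S => Prod.snd '' ((Prod.fst ⁻¹' S) ∩
    {p : Y × Y | p.1 ≠ p.2 ∧ f p.1 = f p.2})
  have mem_N : ∀ {S a b}, a ∈ S → a ≠ b → f a = f b → b ∈ N S := fun {S a b} ha hab h =>
    ⟨(a, b), ⟨ha, hab, h⟩, rfl⟩
  have hpairs : AnalyticSet {p : Y × Y | p.1 ≠ p.2 ∧ f p.1 = f p.2} :=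
    MeasurableSet.analyticSet <|
      (isClosed_eq continuous_fst continuous_snd).isOpen_compl.measurableSet.inter
        (isClosed_eq (hf.comp continuous_fst) (hf.comp continuous_snd)).measurableSet
  have hN : ∀ {S}, AnalyticSet S → AnalyticSet (N S) := fun {S} hS => by
    refine AnalyticSet.image_of_continuous ?_ continuous_snd
    rw [inter_eq_iInter]
    refine AnalyticSet.iInter ?_
    rintro (_ | _)
    · exact hpairs
    · exact hS.preimage continuous_fst
  obtain ⟨B, hAB, hNB, hB⟩ := hA.measurablySeparable (hN hA) <| disjoint_left.2 <| by
    rintro b hb ⟨⟨a, b'⟩, ⟨ha, hab, h⟩, rfl⟩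
    exact hab (hinj ha hb h)
  obtain ⟨C, hAC, hNC, hC⟩ := hA.measurablySeparable (hN hB.analyticSet) <| disjoint_left.2 <| by
    rintro a ha ⟨⟨b, a'⟩, ⟨hb, hab, h⟩, rfl⟩
    exact disjoint_left.1 hNB (mem_N ha (Ne.symm hab) h.symm) hb
  refine ⟨B ∩ C, subset_inter hAB hAC, hB.inter hC, fun a ha b hb h => ?_⟩
  by_contra hab
  exact disjoint_left.1 hNC (mem_N ha.1 hab h) hb.2

/-- If `f` is not countably injective, then there is a nonempty set `S` such that whenever some
fibre of `f` meets all the sets `U i ∩ S`, `i ∈ T`, then for each `j ∈ T` some such fibre meets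
`U j ∩ S` in at least two points. -/
theorem exists_nonempty_forall_two_points {X Y ι : Type*} [Countable ι]
    [TopologicalSpace X] [T2Space X]
    [TopologicalSpace Y] [PolishSpace Y] [MeasurableSpace Y] [BorelSpace Y]
    {f : Y → X} (hf : Continuous f) (hcov : ¬ CountablyInjOn f univ)
    {U : ι → Set Y} (hU : ∀ i, MeasurableSet (U i)) :
    ∃ S : Set Y, S.Nonempty ∧ ∀ (T : Finset ι), ∀ j ∈ T,
      (∃ x, ∀ i ∈ T, x ∈ f '' (U i ∩ S)) →
      ∃ x, (∀ i ∈ T, x ∈ f '' (U i ∩ S)) ∧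
        ∃ y ∈ U j ∩ S, ∃ z ∈ U j ∩ S, y ≠ z ∧ f y = x ∧ f z = x := by
  let P : Finset ι × ι → Set Y → Prop := fun p S => ∃ x, (∀ i ∈ p.1, x ∈ f '' (U i ∩ S)) ∧
    ∃ y ∈ U p.2 ∩ S, ∃ z ∈ U p.2 ∩ S, y ≠ z ∧ f y = x ∧ f z = x
  have P_mono : ∀ p {S S' : Set Y}, S ⊆ S' → P p S → P p S' := by
    rintro p S S' h ⟨x, hx, y, hy, z, hz, hyz⟩
    exact ⟨x, fun i hi => image_mono (inter_subset_inter_right _ h) (hx i hi),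
      y, ⟨hy.1, h hy.2⟩, z, ⟨hz.1, h hz.2⟩, hyz⟩
  have hW : ∀ p, ∃ W : Set Y, (MeasurableSet W ∧ CountablyInjOn f Wᶜ) ∧
      ∀ S, MeasurableSet S → CountablyInjOn f Sᶜ → ¬ P p S → ¬ P p W := by
    intro p
    by_cases h : ∃ S, (MeasurableSet S ∧ CountablyInjOn f Sᶜ) ∧ ¬ P p S
    · obtain ⟨S, hS, hPS⟩ := h
      exact ⟨S, hS, fun _ _ _ _ => hPS⟩
    · refine ⟨univ, ⟨.univ, (CountablyInjOn.of_injOn .empty (injOn_empty f)).mono (by simp)⟩, ?_⟩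
      exact fun S hS hS' hP => (h ⟨S, ⟨hS, hS'⟩, hP⟩).elim
  choose W hW hWP using hW
  set R : Set Y := ⋂ p, W p with hR
  have hRm : MeasurableSet R := MeasurableSet.iInter fun p => (hW p).1
  have hRc : CountablyInjOn f Rᶜ := by
    rw [hR, compl_iInter]
    exact CountablyInjOn.iUnion fun p => (hW p).2
  have hB : ∀ p : Finset ι × ι, ∃ B, MeasurableSet B ∧ InjOn f B ∧ (p.2 ∈ p.1 → ¬ P p R →
      ∀ y ∈ U p.2 ∩ R, (∀ i ∈ p.1, f y ∈ f '' (U i ∩ R)) → y ∈ B) := by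
    intro p
    by_cases h : ¬ P p R
    swap
    · exact ⟨∅, .empty, injOn_empty f, fun _ h' => (h h').elim⟩
    let D : Option p.1 → Set Y := fun o =>
      o.elim (U p.2 ∩ R) fun i => f ⁻¹' (f '' (U i ∩ R))
    have hD : AnalyticSet (⋂ o, D o) := AnalyticSet.iInter <| by
      rintro (_ | i)
      · exact ((hU _).inter hRm).analyticSet
      · exact (((hU _).inter hRm).analyticSet.image_of_continuous hf).preimage hf
    have hDinj : InjOn f (⋂ o, D o) := by
      intro y hy z hz hyz
      rw [mem_iInter] at hy hz
      by_contra hne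
      exact h ⟨f y, fun i hi => hy (some ⟨i, hi⟩), y, hy none, z, hz none, hne, rfl, hyz.symm⟩
    obtain ⟨B, hDB, hBm, hBi⟩ := hD.exists_measurableSet_injOn hf hDinj
    refine ⟨B, hBm, hBi, fun _ _ y hy hyT => hDB (mem_iInter.2 ?_)⟩
    rintro (_ | i)
    · exact hy
    · exact hyT i i.2
  choose B hBm hBi hBmem using hB
  have hSc : CountablyInjOn f (R \ ⋃ p, B p)ᶜ := by
    rw [sdiff_eq, compl_inter, compl_compl]
    exact hRc.union (CountablyInjOn.iUnion fun p => .of_injOn (hBm p) (hBi p))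
  refine ⟨R \ ⋃ p, B p, ?_, ?_⟩
  · rw [nonempty_iff_ne_empty]
    intro h
    rw [h, compl_empty] at hSc
    exact hcov hSc
  · rintro T j hj ⟨x, hx⟩
    by_contra hP
    have hPW := hWP (T, j) _ (hRm.diff (.iUnion hBm)) hSc hP
    have hPR : ¬ P (T, j) R := fun h => hPW (P_mono _ (iInter_subset _ _) h)
    obtain ⟨y, ⟨hyU, hyR, hyB⟩, rfl⟩ := hx j hj
    exact hyB <| mem_iUnion.2 ⟨(T, j), hBmem (T, j) hj hPR y ⟨hyU, hyR⟩ fun i hi =>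
      image_mono (inter_subset_inter_right _ sdiff_subset) (hx i hi)⟩

/-- In a metric space, a splitting of `U j` of size `ε`: two disjoint members of the family `U`
of diameter at most `ε` whose closures are contained in `U j`. -/
def IsSplitting {Y ι : Type*} [PseudoMetricSpace Y] (U : ι → Set Y) (ε : ℝ) (j : ι)
    (g : Bool → ι) : Prop :=
  Disjoint (U (g false)) (U (g true)) ∧
    ∀ b, closure (U (g b)) ⊆ U j ∧ ∀ y ∈ U (g b), ∀ z ∈ U (g b), dist y z ≤ ε

/-- Iterating splittings along which fibres of `f` meet all the chosen sets produces an
uncountable fibre. -/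
theorem exists_not_countable_fiber {X Y ι : Type*} [TopologicalSpace X] [T2Space X]
    [MetricSpace Y] [CompleteSpace Y] {f : Y → X} (hf : Continuous f) {U : ι → Set Y}
    {Q : Finset ι → Prop} (hQ : ∀ T, Q T → ∃ x, ∀ i ∈ T, x ∈ f '' U i)
    {j₀ : ι} (h₀ : Q {j₀})
    (hsplit : ∀ ε > 0, ∀ T, Q T → ∃ (T' : Finset ι) (g : ι → Bool → ι), Q T' ∧
      ∀ j ∈ T, (∀ b, g j b ∈ T') ∧ IsSplitting U ε j (g j)) :
    ∃ x, ¬ (f ⁻¹' {x}).Countable := by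
  have hpos : ∀ n : ℕ, (0 : ℝ) < (1 / 2) ^ n := fun n => by positivity
  have hlim : Filter.Tendsto (fun n : ℕ => (1 / 2 : ℝ) ^ n) Filter.atTop (nhds 0) :=
    tendsto_pow_atTop_nhds_zero_of_lt_one (by norm_num) (by norm_num)
  choose T' g hT' hg using fun (n : ℕ) (T : {T // Q T}) => hsplit _ (hpos n) T.1 T.2
  let T : ℕ → {T // Q T} := fun n =>
    Nat.rec ⟨{j₀}, h₀⟩ (fun n S => ⟨T' n S, hT' n S⟩) n
  let c : (ℕ → Bool) → ℕ → ι := fun b n =>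
    Nat.rec j₀ (fun n j => g n (T n) j (b n)) n
  have hc : ∀ b n, c b n ∈ (T n).1 := by
    intro b n
    induction n with
    | zero => exact Finset.mem_singleton_self j₀
    | succ n ih => exact (hg n (T n) _ ih).1 (b n)
  have hs : ∀ b n, IsSplitting U ((1 / 2) ^ n) (c b n) (g n (T n) (c b n)) := fun b n =>
    (hg n (T n) _ (hc b n)).2
  have hclosure : ∀ b n, closure (U (c b (n + 1))) ⊆ U (c b n) := fun b n => ((hs b n).2 (b n)).1
  have hdist : ∀ b n, ∀ y ∈ U (c b (n + 1)), ∀ z ∈ U (c b (n + 1)), dist y z ≤ (1 / 2) ^ n :=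
    fun b n => ((hs b n).2 (b n)).2
  have hanti : ∀ b, Antitone fun n => U (c b n) := fun b =>
    antitone_nat_of_succ_le fun n => subset_closure.trans (hclosure b n)
  have hpair : ∀ b b' n, ∃ y ∈ U (c b n), ∃ z ∈ U (c b' n), f y = f z := by
    intro b b' n
    obtain ⟨x, hx⟩ := hQ _ (T n).2
    obtain ⟨y, hy, hyx⟩ := hx _ (hc b n)
    obtain ⟨z, hz, hzx⟩ := hx _ (hc b' n)
    exact ⟨y, hy, z, hz, hyx.trans hzx.symm⟩
  have hpoint : ∀ b, ∃ y, ∀ n, y ∈ U (c b n) := by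
    intro b
    choose p hp _ using hpair b b
    have hcauchy : CauchySeq fun n => p (n + 1) :=
      cauchySeq_of_le_tendsto_0' _ (fun n m hnm => hdist b n _ (hp (n + 1)) _
        (hanti b (Nat.succ_le_succ hnm) (hp (m + 1)))) hlim
    obtain ⟨y, hy⟩ := cauchySeq_tendsto_of_complete hcauchy
    refine ⟨y, fun n => hclosure b n (mem_closure_of_tendsto hy ?_)⟩
    filter_upwards [Filter.eventually_ge_atTop n] with m hm
    exact hanti b (Nat.succ_le_succ hm) (hp (m + 1))
  choose y hy using hpoint
  have htendsto : ∀ b (p : ℕ → Y), (∀ n, p n ∈ U (c b (n + 1))) →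
      Filter.Tendsto p Filter.atTop (nhds (y b)) := fun b p hp =>
    tendsto_iff_dist_tendsto_zero.2 <| squeeze_zero (fun _ => dist_nonneg)
      (fun n => hdist b n _ (hp n) _ (hy b (n + 1))) hlim
  have hconst : ∀ b b', f (y b) = f (y b') := by
    intro b b'
    choose p hp q hq hpq using fun n => hpair b b' (n + 1)
    have h1 := (hf.tendsto _).comp (htendsto b p hp)
    have h2 := (hf.tendsto _).comp (htendsto b' q hq)
    rw [show f ∘ p = f ∘ q from funext hpq] at h1
    exact tendsto_nhds_unique h1 h2
  have hinj : Function.Injective y := by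
    intro b b' hbb'
    by_contra hne
    have hex : ∃ n, b n ≠ b' n := Function.ne_iff.1 hne
    classical
    have hlt : ∀ n ≤ Nat.find hex, c b n = c b' n := by
      intro n
      induction n with
      | zero => exact fun _ => rfl
      | succ n ih =>
        intro hn
        have h1 := ih (Nat.le_of_succ_le hn)
        have h2 : b n = b' n := not_not.1 (Nat.find_min hex hn)
        change g n (T n) (c b n) (b n) = g n (T n) (c b' n) (b' n)
        rw [h1, h2]
    set n := Nat.find hex
    have h1 : y b ∈ U (g n (T n) (c b n) (b n)) := hy b (n + 1)
    have h2 : y b ∈ U (g n (T n) (c b n) (b' n)) := by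
      have := hy b' (n + 1)
      rw [← hbb'] at this
      rw [hlt n le_rfl]
      exact this
    have hn : b n ≠ b' n := Nat.find_spec hex
    have hd := disjoint_left.1 (hs b n).1
    cases hb : b n <;> cases hb' : b' n <;> rw [hb] at h1 hn <;> rw [hb'] at h2 hn
    · exact hn rfl
    · exact hd h1 h2
    · exact hd h2 h1
    · exact hn rfl
  refine ⟨f (y fun _ => false), fun hcount => ?_⟩
  have huniv : (univ : Set (ℕ → Bool)).Countable :=
    (hcount.preimage hinj).mono fun b _ => hconst b _
  have := countable_univ_iff.1 huniv
  obtain ⟨e, he⟩ := exists_surjective_nat (ℕ → Bool)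
  obtain ⟨n, hn⟩ := he fun n => !(e n n)
  simpa using congrFun hn n

/-- A continuous function with countable fibres on a Polish space is countably injective. -/
theorem countablyInjOn_univ_of_countable_fibers {X Y : Type*}
    [TopologicalSpace X] [T2Space X]
    [TopologicalSpace Y] [PolishSpace Y] [MeasurableSpace Y] [BorelSpace Y]
    {f : Y → X} (hf : Continuous f) (hcount : ∀ x, (f ⁻¹' {x}).Countable) :
    CountablyInjOn f univ := by
  by_contra hcov
  let := TopologicalSpace.upgradeIsCompletelyMetrizable Y
  let U : TopologicalSpace.countableBasis Y → Set Y := Subtype.val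
  have hbasis := TopologicalSpace.isBasis_countableBasis Y
  have hUo : ∀ i, IsOpen (U i) := fun i => hbasis.isOpen i.2
  have : Countable (TopologicalSpace.countableBasis Y) :=
    (TopologicalSpace.countable_countableBasis Y).to_subtype
  have hUbasis : ∀ {y : Y} {O : Set Y} {ε : ℝ}, IsOpen O → y ∈ O → 0 < ε →
      ∃ i, y ∈ U i ∧ closure (U i) ⊆ O ∧ ∀ a ∈ U i, ∀ b ∈ U i, dist a b ≤ ε := by
    intro y O ε hO hy hε
    have hmem : O ∩ Metric.closedBall y (ε / 2) ∈ nhds y :=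
      Filter.inter_mem (hO.mem_nhds hy) (Metric.closedBall_mem_nhds y (by positivity))
    obtain ⟨C, hC, hCc, hCO⟩ := exists_mem_nhds_isClosed_subset hmem
    obtain ⟨V, hV, hyV, hVC⟩ := hbasis.mem_nhds_iff.1 hC
    refine ⟨⟨V, hV⟩, hyV, fun z hz => (hCO (closure_minimal hVC hCc hz)).1, fun a ha b hb => ?_⟩
    have h1 : dist a y ≤ ε / 2 := (hCO (hVC ha)).2
    have h2 : dist b y ≤ ε / 2 := (hCO (hVC hb)).2
    linarith [dist_triangle_right a b y]
  obtain ⟨S, ⟨y₀, hy₀⟩, hS⟩ :=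
    exists_nonempty_forall_two_points hf hcov fun i => (hUo i).measurableSet
  let Q : Finset (TopologicalSpace.countableBasis Y) → Prop := fun T =>
    ∃ x, ∀ i ∈ T, x ∈ f '' (U i ∩ S)
  obtain ⟨j₀, hj₀, -⟩ := hUbasis isOpen_univ (mem_univ y₀) one_pos
  classical
  have hsplit : ∀ ε > 0, ∀ T, Q T → ∀ j ∈ T, ∃ T' ⊇ T, Q T' ∧
      ∃ g : Bool → _, (∀ b, g b ∈ T') ∧ IsSplitting U ε j g := by
    intro ε hε T hT j hj
    obtain ⟨x, hx, y, hy, z, hz, hyz, hyx, hzx⟩ := hS T j hj hT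
    obtain ⟨V, W, hV, hW, hyV, hzW, hVW⟩ := t2_separation hyz
    obtain ⟨m, hym, hm, hm'⟩ := hUbasis ((hUo j).inter hV) ⟨hy.1, hyV⟩ hε
    obtain ⟨n, hzn, hn, hn'⟩ := hUbasis ((hUo j).inter hW) ⟨hz.1, hzW⟩ hε
    refine ⟨insert m (insert n T),
      (Finset.subset_insert _ _).trans (Finset.subset_insert _ _), ⟨x, fun i hi => ?_⟩,
      fun b => cond b n m, ?_, ?_, ?_⟩
    · rw [Finset.mem_insert, Finset.mem_insert] at hi
      obtain rfl | rfl | hi := hi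
      · exact ⟨y, ⟨hym, hy.2⟩, hyx⟩
      · exact ⟨z, ⟨hzn, hz.2⟩, hzx⟩
      · exact hx i hi
    · rintro (_ | _) <;> simp
    · exact hVW.mono (fun a ha => (hm (subset_closure ha)).2)
        (fun a ha => (hn (subset_closure ha)).2)
    · rintro (_ | _)
      · exact ⟨fun a ha => (hm ha).1, hm'⟩
      · exact ⟨fun a ha => (hn ha).1, hn'⟩
  obtain ⟨x, hx⟩ := exists_not_countable_fiber (Q := Q) (j₀ := j₀) hf
    (fun T ⟨x, hx⟩ => ⟨x, fun i hi => image_mono inter_subset_left (hx i hi)⟩)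
    ⟨f y₀, fun i hi => by
      rw [Finset.mem_singleton.1 hi]
      exact ⟨y₀, ⟨hj₀, hy₀⟩, rfl⟩⟩ <| by
    intro ε hε T hT
    have key : ∀ P : Finset (TopologicalSpace.countableBasis Y), P ⊆ T → ∃ T' ⊇ T, Q T' ∧
        ∀ j ∈ P, ∃ g : Bool → _, (∀ b, g b ∈ T') ∧ IsSplitting U ε j g := by
      intro P
      induction P using Finset.induction_on with
      | empty => exact fun _ => ⟨T, subset_rfl, hT, by simp⟩
      | insert j P _ ih =>
        intro hP
        obtain ⟨T₁, hTT₁, hQ₁, h₁⟩ := ih ((Finset.subset_insert _ _).trans hP)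
        obtain ⟨T₂, hT₁T₂, hQ₂, h₂⟩ :=
          hsplit ε hε T₁ hQ₁ j (hTT₁ (hP (Finset.mem_insert_self _ _)))
        refine ⟨T₂, hTT₁.trans hT₁T₂, hQ₂, fun i hi => ?_⟩
        obtain rfl | hi := Finset.mem_insert.1 hi
        · exact h₂
        · obtain ⟨g, hg, hg'⟩ := h₁ i hi
          exact ⟨g, fun b => hT₁T₂ (hg b), hg'⟩
    obtain ⟨T', -, hQ', h'⟩ := key T subset_rfl
    have : Nonempty (TopologicalSpace.countableBasis Y) := ⟨j₀⟩
    choose! g hg using h'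
    exact ⟨T', g, hQ', hg⟩
  exact hx (hcount x)

/-- The range of a countable-to-one Borel function between standard Borel spaces is Borel. -/
theorem Measurable.measurableSet_range_of_countable_fibers_s13 {X Y : Type*}
    [MeasurableSpace X] [StandardBorelSpace X] [MeasurableSpace Y] [StandardBorelSpace Y]
    {f : Y → X} (hf : Measurable f) (hcount : ∀ x, (f ⁻¹' {x}).Countable) :
    MeasurableSet (range f) := by
  let := upgradeStandardBorel X
  have hcov : CountablyInjOn f univ := by
    let := upgradeStandardBorel Y
    let tY : TopologicalSpace Y := inferInstance
    obtain ⟨t', ht', hf', hpol⟩ := hf.exists_continuous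
    have hbor : @BorelSpace Y t' _ :=
      @BorelSpace.mk _ t' _ <| (eq_borel_upgradeStandardBorel Y).trans
        (borel_eq_borel_of_le (t' := tY) hpol inferInstance ht').symm
    exact @countablyInjOn_univ_of_countable_fibers X Y _ _ t' hpol _ hbor f hf' hcount
  obtain ⟨B, hB, huniv⟩ := hcov
  rw [← image_univ, ← univ_subset_iff.1 huniv, image_iUnion]
  exact .iUnion fun n => (hB n).1.image_of_measurable_injOn hf (hB n).2

/-- **Lusin–Novikov**: the projection of a Borel set with countable sections is Borel. -/
theorem MeasurableSet.image_fst_of_countable_sections {X Y : Type*}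
    [MeasurableSpace X] [StandardBorelSpace X] [MeasurableSpace Y] [StandardBorelSpace Y]
    {R : Set (X × Y)} (hR : MeasurableSet R) (hcount : ∀ x, {y | (x, y) ∈ R}.Countable) :
    MeasurableSet {x | ∃ y, (x, y) ∈ R} := by
  have := hR.standardBorel
  have hrange := (measurable_fst.comp (measurable_subtype_coe (p := (· ∈ R)))
    ).measurableSet_range_of_countable_fibers_s13 fun x => by
      refine ((hcount x).image (Prod.mk x)).preimage Subtype.val_injective |>.mono ?_
      rintro ⟨⟨a, y⟩, h⟩ rfl
      exact ⟨y, h, rfl⟩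
  convert hrange
  ext x
  simp

section QuotientRelations

variable {X : Type} [MeasurableSpace X]

/-- The preimage in `X` of a countable set of classes of a countable Borel equivalence relation
is countable. -/
theorem CBER.countable_preimage {E : Setoid X} (hE : CBER E) {A : Set (Quotient E)}
    (hA : A.Countable) : (Quotient.mk E ⁻¹' A).Countable := by
  rw [← biUnion_preimage_singleton]
  refine hA.biUnion fun q _ => ?_
  obtain ⟨x, rfl⟩ := Quotient.exists_rep q
  exact (hE.2 x).mono fun y hy => E.symm (Quotient.exact hy)

/-- The composition of two Borel relations with countable sections on the quotient by a countable
Borel equivalence relation is Borel. -/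
theorem CBER.qBorelRel_comp [StandardBorelSpace X] {E : Setoid X} (hE : CBER E)
    {r s : Quotient E → Quotient E → Prop}
    (hr : QBorelRel E E {p | r p.1 p.2}) (hs : QBorelRel E E {p | s p.1 p.2})
    (hrc : ∀ a, {b | r a b}.Countable) :
    QBorelRel E E {p | Relation.Comp r s p.1 p.2} := by
  let R : Set ((X × X) × X) := {t | r (Quotient.mk E t.1.1) (Quotient.mk E t.2) ∧
    s (Quotient.mk E t.2) (Quotient.mk E t.1.2)}
  have hR : MeasurableSet R :=
    ((measurable_fst.fst.prodMk measurable_snd) hr).inter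
      ((measurable_snd.prodMk measurable_fst.snd) hs)
  have := hR.image_fst_of_countable_sections fun p =>
    (hE.countable_preimage (hrc (Quotient.mk E p.1))).mono fun y hy => hy.1
  rw [QBorelRel]
  convert this using 1
  ext p
  refine ⟨fun ⟨b, hb⟩ => ?_, fun ⟨y, hy⟩ => ⟨Quotient.mk E y, hy⟩⟩
  obtain ⟨y, rfl⟩ := Quotient.exists_rep b
  exact ⟨y, hb⟩

/-- The reflexive transitive closure of a Borel relation with countable sections on the quotient
by a countable Borel equivalence relation is Borel and has countable sections. -/
theorem CBER.qBorelRel_reflTransGen [StandardBorelSpace X] {E : Setoid X} (hE : CBER E)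
    {r : Quotient E → Quotient E → Prop} (hr : QBorelRel E E {p | r p.1 p.2})
    (hrc : ∀ a, {b | r a b}.Countable) :
    QBorelRel E E {p | Relation.ReflTransGen r p.1 p.2} ∧
      ∀ a, {b | Relation.ReflTransGen r a b}.Countable := by
  let C : ℕ → Quotient E → Quotient E → Prop := fun n =>
    Nat.rec Eq (fun _ c => Relation.Comp c r) n
  have hC : ∀ n, QBorelRel E E {p | C n p.1 p.2} ∧ ∀ a, {b | C n a b}.Countable := by
    intro n
    induction n with
    | zero =>
      refine ⟨?_, fun a => (countable_singleton a).mono fun b hb => Eq.symm hb⟩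
      rw [QBorelRel]
      convert hE.1 using 1
      ext p
      exact Quotient.eq
    | succ n ih =>
      refine ⟨hE.qBorelRel_comp ih.1 hr ih.2, fun a => ?_⟩
      refine ((ih.2 a).biUnion fun b _ => hrc b).mono ?_
      rintro c ⟨b, hab, hbc⟩
      exact mem_biUnion hab hbc
  have hiff : ∀ a b, Relation.ReflTransGen r a b ↔ ∃ n, C n a b := by
    refine fun a b => ⟨fun h => ?_, ?_⟩
    · induction h with
      | refl => exact ⟨0, rfl⟩
      | tail _ hbc ih =>
        obtain ⟨n, hn⟩ := ih
        exact ⟨n + 1, _, hn, hbc⟩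
    · rintro ⟨n, hn⟩
      induction n generalizing b with
      | zero => exact hn ▸ .refl
      | succ n ih =>
        obtain ⟨c, hac, hcb⟩ := hn
        exact (ih c hac).tail hcb
  simp only [hiff, ofPred_exists]
  refine ⟨?_, fun a => countable_iUnion fun n => (hC n).2 a⟩
  unfold QBorelRel
  simp only [mem_iUnion, ofPred_exists]
  exact .iUnion fun n => (hC n).1

end QuotientRelations

/-- the equivalence relation generated by countably many countable-to-one Borel
endomorphisms of a quotient Borel space is a countable Borel equivalence relation. -/
theorem stmt_13 {X : Type} [MeasurableSpace X] [StandardBorelSpace X]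
    (E : Setoid X) (hE : CBER E)
    (f : ℕ → Quotient E → Quotient E)
    (hfB : ∀ n, QBorelFun E E (f n))
    (hfc : ∀ n (q : Quotient E), (f n ⁻¹' {q}).Countable) :
    QBorelRel E E {p | Relation.EqvGen (fun a b => ∃ n, f n a = b) p.1 p.2} ∧
    ∀ q : Quotient E, {y | Relation.EqvGen (fun a b => ∃ n, f n a = b) q y}.Countable := by
  rw [← Relation.EqvGen.reflTransGen_symmGen]
  refine hE.qBorelRel_reflTransGen ?_ fun a => ?_
  · have hgraph : MeasurableSet {p : X × X | ∃ n, f n (Quotient.mk E p.1) = Quotient.mk E p.2} := by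
      rw [ofPred_exists]
      exact .iUnion hfB
    exact hgraph.union (measurable_swap hgraph)
  · have hout : {b | ∃ n, f n a = b}.Countable := countable_range fun n => f n a
    have hin : {b | ∃ n, f n b = a}.Countable := by
      rw [ofPred_exists]
      exact countable_iUnion fun n => hfc n a
    exact hout.union hin
end
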